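/- For every n ≥ 1 and every class function χ : S_n → Q, the average of χ over the symmetric group equals the average over monic degree-n polynomials f over F_q of χ(σ_f), where χ(σ_f) is defined as the average of χ over the coset τ_f H_f ⊆ S_n determined by the Frobenius action on the multiset of roots of f. (Equal expectations: E_{Poly^n(F_q)}[χ] = E_{S_n}[χ].) -/

import Mathlib

open Polynomial UniqueFactorizationMonoid

/-- `cycleCount σ k` is the number of `k`-cycles of `σ` (with `1`-cycles = fixed points). -/
def cycleCount {α : Type*} [Fintype α] [DecidableEq α] (σ : Equiv.Perm α) (k : ℕ) : ℕ :=
  if k = 1 then (Finset.univ.filter fun x => σ x = x).card else Multiset.count k σ.cycleType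

/-- The permutation of the grid `{1,…,r} × Z/dZ` acting by `h k` on the fiber over `k`. -/
def gridPerm (r d : ℕ) (h : Fin d → Equiv.Perm (Fin r)) : Equiv.Perm (Fin r × Fin d) where
  toFun p := (h p.2 p.1, p.2)
  invFun p := ((h p.2).symm p.1, p.2)
  left_inv p := by simp
  right_inv p := by simp

variable {F : Type*} [Field F] [DecidableEq F]

/-- The finite set of distinct monic irreducible factors of `f`. -/
noncomputable def facSet (f : F[X]) : Finset F[X] := (normalizedFactors f).toFinset

/-- The set of roots of `f` with multiplicity: `T_f = {(p,j,k) : p ∣ f irreducible,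
1 ≤ j ≤ r_p, k ∈ Z/d_pZ}` where `r_p` is the multiplicity of `p` in `f` and
`d_p = deg p`. -/
abbrev Tf (f : F[X]) :=
  Σ p : {x // x ∈ facSet f},
    Fin ((normalizedFactors f).count (p : F[X])) × Fin ((p : F[X]).natDegree)

/-- The Young subgroup `H_f = ∏ᵢ (S_{rᵢ})^{dᵢ}` stabilizing the root tuple of `f`. -/
abbrev Hf (f : F[X]) :=
  ∀ p : {x // x ∈ facSet f},
    Fin ((p : F[X]).natDegree) → Equiv.Perm (Fin ((normalizedFactors f).count (p : F[X])))

/-- The lift `τ_f(i,j,k) = (i,j,k+1)` of the Frobenius action on the roots of `f`. -/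
noncomputable def tauF (f : F[X]) : Equiv.Perm (Tf f) :=
  Equiv.sigmaCongrRight fun _ => (Equiv.refl _).prodCongr (finRotate _)

/-- The permutation of `T_f` induced by `h ∈ H_f`. -/
noncomputable def hPermF (f : F[X]) (h : Hf f) : Equiv.Perm (Tf f) :=
  Equiv.sigmaCongrRight fun p => gridPerm _ _ (h p)

/-- The monic polynomial of degree `n` with coefficient tuple `c`. -/
noncomputable def monicOf {F : Type*} [Field F] (n : ℕ) (c : Fin n → F) : F[X] :=
  X ^ n + ∑ i : Fin n, C (c i) * X ^ (i : ℕ)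


/-- Number of solutions of `x (σ i) = φ (x i)`. -/
theorem aux_orbit_count {α L : Type*} [Fintype α] [DecidableEq α] [Fintype L] (φ : L → L) (q : ℕ)
    (hq : ∀ k, 0 < k → k ≤ Fintype.card α → Nat.card {y // φ^[k] y = y} = q ^ k)
    (σ : Equiv.Perm α) :
    Nat.card {x : α → L // ∀ i, x (σ i) = φ (x i)} = q ^ Fintype.card α := by
  classical
  let Ω := MulAction.orbitRel.Quotient (Subgroup.zpowers σ) α
  let b : Ω → α := Quotient.out
  let k : Ω → ℕ := fun o => Function.minimalPeriod σ (b o)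
  have hk : ∀ o, k o = Fintype.card (MulAction.orbit (Subgroup.zpowers σ) (b o)) := fun o => by
    rw [← MulAction.minimalPeriod_eq_card]; rfl
  have hkpos : ∀ o, 0 < k o := fun o => by
    rw [hk]
    exact Fintype.card_pos_iff.2 ⟨⟨b o, MulAction.mem_orbit_self _⟩⟩
  have hkle : ∀ o, k o ≤ Fintype.card α := fun o => by
    rw [hk]; exact Fintype.card_subtype_le _
  have hsum : ∑ o, k o = Fintype.card α := by
    rw [Fintype.card_congr (MulAction.selfEquivSigmaOrbits (Subgroup.zpowers σ) α),
      Fintype.card_sigma]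
    exact Finset.sum_congr rfl fun o _ => hk o
  have hiter : ∀ x : α → L, (∀ i, x (σ i) = φ (x i)) → ∀ j i, x (σ^[j] i) = φ^[j] (x i) := by
    intro x hx j
    induction j with
    | zero => intro i; rfl
    | succ j ih => intro i; rw [Function.iterate_succ_apply', hx, ih,
        Function.iterate_succ_apply']
  have hreach : ∀ a : α, ∃ j : ℕ, σ^[j] (b (Quotient.mk'' a)) = a := by
    intro a
    have h1 : (MulAction.orbitRel (Subgroup.zpowers σ) α) a (b (Quotient.mk'' a)) :=
      (MulAction.orbitRel (Subgroup.zpowers σ) α).symm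
        (Quotient.mk_out (s := MulAction.orbitRel (Subgroup.zpowers σ) α) a)
    rw [MulAction.orbitRel_apply] at h1
    obtain ⟨⟨g, hg⟩, h2⟩ := h1
    have hg' := hg
    rw [← mem_powers_iff_mem_zpowers] at hg'
    obtain ⟨j, rfl⟩ := hg'
    refine ⟨j, ?_⟩
    rw [← Equiv.Perm.coe_pow]
    exact h2
  choose j hj using hreach
  have hwd : ∀ (o : Ω) (y : L), φ^[k o] y = y → ∀ m m', σ^[m] (b o) = σ^[m'] (b o) →
      φ^[m] y = φ^[m'] y := by
    intro o y hy m m' hm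
    have h1 : m % k o = m' % k o :=
      (Function.iterate_eq_iterate_iff_of_lt_minimalPeriod (f := σ) (x := b o)
        (Nat.mod_lt _ (hkpos o)) (Nat.mod_lt _ (hkpos o))).1 (by
        rw [Function.iterate_mod_minimalPeriod_eq, Function.iterate_mod_minimalPeriod_eq, hm])
    have h2 : ∀ m, φ^[m] y = φ^[m % k o] y := fun m =>
      ((show Function.IsPeriodicPt φ (k o) y from hy).iterate_mod_apply m).symm
    rw [h2 m, h2 m', h1]
  have hmk : ∀ a, (Quotient.mk'' (σ a) : Ω) = Quotient.mk'' a := by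
    intro a
    apply Quotient.sound'
    rw [MulAction.orbitRel_apply]
    exact ⟨⟨σ, Subgroup.mem_zpowers σ⟩, rfl⟩
  have hbmk : ∀ o : Ω, (Quotient.mk'' (b o) : Ω) = o := fun o => Quotient.out_eq' o
  let E : {x : α → L // ∀ i, x (σ i) = φ (x i)} ≃ ∀ o : Ω, {y : L // φ^[k o] y = y} :=
    { toFun := fun x o => ⟨x.1 (b o), by
        rw [← hiter x.1 x.2, Function.iterate_minimalPeriod]⟩
      invFun := fun y => ⟨fun a => φ^[j a] (y (Quotient.mk'' a)).1, by
        intro a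
        beta_reduce
        rw [← Function.iterate_succ_apply' (f := φ), hmk a]
        apply hwd _ _ (y _).2
        rw [Function.iterate_succ_apply', hj a, ← hmk a, hj (σ a)]⟩
      left_inv := by
        intro x
        ext a
        simp only
        rw [← hiter x.1 x.2, hj]
      right_inv := by
        intro y
        ext o
        simp only
        have h0 := hj (b o)
        have := hbmk o
        revert h0
        generalize j (b o) = m
        rw [this]
        intro h0
        exact hwd o _ (y o).2 m 0 h0 }
  rw [Nat.card_congr E, Nat.card_pi, ← hsum, ← Finset.prod_pow_eq_pow_sum]
  exact Finset.prod_congr rfl fun o _ => hq _ (hkpos o) (hkle o)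

theorem aux_exists_equiv {α β L : Type*} [Fintype α] [Fintype β] (f : α → L) (g : β → L)
    (h : (Finset.univ.val.map f) = Finset.univ.val.map g) : ∃ e : α ≃ β, ∀ a, g (e a) = f a := by
  classical
  have key : ∀ c, Nonempty ({a // f a = c} ≃ {b // g b = c}) := by
    intro c
    rw [← Fintype.card_eq, Fintype.card_subtype, Fintype.card_subtype]
    have := congrArg (Multiset.count c) h
    rw [Multiset.count_map, Multiset.count_map] at this
    simpa [Finset.card_def, Finset.filter_val, eq_comm] using this
  exact ⟨Equiv.ofFiberEquiv fun c => (key c).some, fun a => Equiv.ofFiberEquiv_map _ a⟩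

open Classical in
theorem aux_coset_sum {T L H : Type*} {n : ℕ} [Fintype T] [Fintype L] [Fintype H]
    (x0 : T → L) (τ : Equiv.Perm T) (φ : L → L) (hφ : Function.Injective φ)
    (hτ : ∀ t, x0 (τ t) = φ (x0 t)) (hP : H → Equiv.Perm T) (hinj : Function.Injective hP)
    (hrange : ∀ π : Equiv.Perm T, (∃ h, hP h = π) ↔ ∀ t, x0 (π t) = x0 t)
    (χ : Equiv.Perm (Fin n) → ℚ)
    (hχ : ∀ g h : Equiv.Perm (Fin n), χ (h * g * h⁻¹) = χ g) (e : T ≃ Fin n) :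
    (Nat.factorial n : ℚ) * ∑ h : H, χ (e.permCongr (τ * hP h)) =
      (Fintype.card H : ℚ) * ∑ x ∈ Finset.univ.filter
        (fun x : Fin n → L => ∃ g : T ≃ Fin n, ∀ t, x (g t) = x0 t),
        ∑ σ ∈ Finset.univ.filter (fun σ : Equiv.Perm (Fin n) => ∀ i, x (σ i) = φ (x i)), χ σ := by
  let B : (Fin n → L) → ℚ := fun x =>
    ∑ σ ∈ Finset.univ.filter (fun σ : Equiv.Perm (Fin n) => ∀ i, x (σ i) = φ (x i)), χ σ
  have h1 : ∀ g : T ≃ Fin n, ∑ h : H, χ (g.permCongr (τ * hP h)) =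
      ∑ h : H, χ (e.permCongr (τ * hP h)) := by
    intro g
    refine Finset.sum_congr rfl fun h _ => ?_
    rw [← hχ (e.permCongr (τ * hP h)) (e.symm.trans g)]
    congr 1
    ext i
    simp [Equiv.permCongr_apply, Equiv.Perm.inv_def]
  have h2 : ∀ g : T ≃ Fin n, ∑ h : H, χ (g.permCongr (τ * hP h)) = B (x0 ∘ g.symm) := by
    intro g
    refine Finset.sum_bij (fun h _ => g.permCongr (τ * hP h)) ?_ ?_ ?_ ?_
    · intro h _
      simp only [Finset.mem_filter, Finset.mem_univ, true_and]
      intro i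
      simp [Equiv.permCongr_apply, hτ, (hrange (hP h)).1 ⟨h, rfl⟩]
    · intro a _ b _ hab
      exact hinj (mul_left_cancel (g.permCongr.injective hab))
    · intro σ hσ
      simp only [Finset.mem_filter, Finset.mem_univ, true_and] at hσ
      obtain ⟨h, hh⟩ := (hrange (τ⁻¹ * g.permCongr.symm σ)).2 (by
        intro t
        apply hφ
        rw [← hτ]
        have := hσ (g t)
        simpa [Equiv.permCongr_symm, Equiv.permCongr_apply] using this)
      refine ⟨h, Finset.mem_univ _, ?_⟩
      rw [hh, mul_inv_cancel_left, Equiv.apply_symm_apply]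
    · intro _ _; rfl
  have h3 : ∑ g : T ≃ Fin n, B (x0 ∘ g.symm) =
      (Nat.factorial n : ℚ) * ∑ h : H, χ (e.permCongr (τ * hP h)) := by
    simp_rw [← h2, h1]
    rw [Finset.sum_const, Finset.card_univ, Fintype.card_equiv e, Fintype.card_congr e,
      Fintype.card_fin, nsmul_eq_mul]
  rw [← h3, Finset.mul_sum]
  rw [← Finset.sum_fiberwise_of_maps_to (s := Finset.univ)
    (t := Finset.univ.filter (fun x : Fin n → L => ∃ g : T ≃ Fin n, ∀ t, x (g t) = x0 t))
    (g := fun g : T ≃ Fin n => x0 ∘ g.symm)]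
  · refine Finset.sum_congr rfl fun x hx => ?_
    simp only [Finset.mem_filter, Finset.mem_univ, true_and] at hx
    obtain ⟨g, hg⟩ := hx
    rw [Finset.sum_congr rfl (g := fun _ => B x) (by
      intro g' hg'
      rw [(Finset.mem_filter.1 hg').2]), Finset.sum_const, nsmul_eq_mul]
    congr 2
    rw [← Finset.card_univ]
    symm
    refine Finset.card_bij (fun h _ => (hP h).trans g) ?_ ?_ ?_
    · intro h _
      simp only [Finset.mem_filter, Finset.mem_univ, true_and]
      funext i
      have := (hrange (hP h)).1 ⟨h, rfl⟩ ((hP h).symm (g.symm i))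
      simp only [Equiv.apply_symm_apply] at this
      simp only [Function.comp_apply, Equiv.symm_trans_apply]
      rw [← this, ← hg]; simp
    · intro a _ b _ hab
      apply hinj
      ext t
      exact g.injective (congrArg (fun k : T ≃ Fin n => k t) hab)
    · intro g' hg'
      simp only [Finset.mem_filter, Finset.mem_univ, true_and] at hg'
      obtain ⟨h, hh⟩ := (hrange (g'.trans g.symm)).2 (by
        intro t
        have := congrFun hg' (g' t)
        simp only [Function.comp_apply, Equiv.symm_apply_apply] at this
        rw [this, ← hg]; simp)
      refine ⟨h, Finset.mem_univ _, ?_⟩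
      rw [hh]; ext; simp
  · intro g _
    simp only [Finset.mem_filter, Finset.mem_univ, true_and]
    exact ⟨g, fun t => by simp⟩

section aux_field

variable {L : Type*} [Field L] [Algebra F L] [Fintype F]

theorem aux_fix_count [Fintype L] {N k : ℕ} (hN : N ≠ 0) (hk : 0 < k) (hkN : k ∣ N)
    (hL : Splits ((X ^ Fintype.card F ^ N - X : F[X]).map (algebraMap F L))) :
    Nat.card {y : L // y ^ Fintype.card F ^ k = y} = Fintype.card F ^ k := by
  classical
  obtain ⟨p, hp⟩ := CharP.exists F
  have hq1 : 1 < Fintype.card F := Fintype.one_lt_card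
  have hpq : p ∣ Fintype.card F ^ k :=
    dvd_pow ((CharP.cast_eq_zero_iff F p _).1 (FiniteField.cast_card_eq_zero F)) hk.ne'
  have hsep := galois_poly_separable (K := F) p (Fintype.card F ^ k) hpq
  have hne : (X ^ Fintype.card F ^ N - X : F[X]).map (algebraMap F L) ≠ 0 :=
    Polynomial.map_ne_zero (FiniteField.X_pow_card_pow_sub_X_ne_zero F hN hq1)
  have hspl : Splits ((X ^ Fintype.card F ^ k - X : F[X]).map (algebraMap F L)) :=
    hL.of_dvd hne (Polynomial.map_dvd _ (dvd_pow_pow_sub_self_of_dvd hkN))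
  have := card_rootSet_eq_natDegree hsep hspl
  rw [FiniteField.X_pow_card_pow_sub_X_natDegree_eq F hk.ne' hq1] at this
  refine Eq.trans ?_ this
  refine Eq.trans ?_ Nat.card_eq_fintype_card
  have hiff : ∀ y : L, y ^ Fintype.card F ^ k = y ↔
      y ∈ (X ^ Fintype.card F ^ k - X : F[X]).rootSet L := by
    intro y
    rw [mem_rootSet]
    simp [FiniteField.X_pow_card_pow_sub_X_ne_zero F hk.ne' hq1, sub_eq_zero]
  exact Nat.card_congr (Equiv.subtypeEquivRight hiff)

theorem aux_mem_range [Fintype L] {N : ℕ} (hN : N ≠ 0)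
    (hL : Splits ((X ^ Fintype.card F ^ N - X : F[X]).map (algebraMap F L)))
    (y : L) (hy : y ^ Fintype.card F = y) : ∃ a : F, algebraMap F L a = y := by
  classical
  have h1 := aux_fix_count hN one_pos (one_dvd N) hL
  rw [pow_one, Nat.card_eq_fintype_card] at h1
  let g : F → {y : L // y ^ Fintype.card F = y} := fun a =>
    ⟨algebraMap F L a, by rw [← map_pow, FiniteField.pow_card]⟩
  have hg : Function.Injective g := fun a b hab =>
    (algebraMap F L).injective (congrArg Subtype.val hab)
  have := (Fintype.bijective_iff_injective_and_card g).2 ⟨hg, h1.symm⟩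
  obtain ⟨a, ha⟩ := this.2 ⟨y, hy⟩
  exact ⟨a, congrArg Subtype.val ha⟩

theorem aux_root {N : ℕ} (hN : N ≠ 0)
    (hL : Splits ((X ^ Fintype.card F ^ N - X : F[X]).map (algebraMap F L)))
    {p : F[X]} (hp : Irreducible p) (hd : p.natDegree ∣ N) : ∃ a : L, aeval a p = 0 := by
  have hne : (X ^ Fintype.card F ^ N - X : F[X]).map (algebraMap F L) ≠ 0 :=
    Polynomial.map_ne_zero (FiniteField.X_pow_card_pow_sub_X_ne_zero F hN Fintype.one_lt_card)
  have hdvd := hp.natDegree_dvd_iff_dvd_X_pow_card_pow_sub_X.1 hd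
  rw [Nat.card_eq_fintype_card] at hdvd
  have hspl := hL.of_dvd hne (Polynomial.map_dvd (algebraMap F L) hdvd)
  obtain ⟨a, ha⟩ := hspl.exists_eval_eq_zero (by
    rw [degree_map]; exact (degree_pos_of_irreducible hp).ne')
  exact ⟨a, by rwa [aeval_def, ← eval_map]⟩

theorem aux_pow_iff {p : F[X]} (hp : Irreducible p) {a : L} (ha : aeval a p = 0) (m : ℕ) :
    a ^ Fintype.card F ^ m = a ↔ p.natDegree ∣ m := by
  rw [hp.natDegree_dvd_iff_dvd_X_pow_card_pow_sub_X, Nat.card_eq_fintype_card,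
    ← hp.dvd_iff_aeval_eq_zero ha]
  simp [sub_eq_zero]

theorem aux_frob_inj : Function.Injective (fun y : L => y ^ Fintype.card F) :=
  (FiniteField.frobeniusAlgHom F L).toRingHom.injective

theorem aux_frob_iterate (k : ℕ) (y : L) :
    (fun y : L => y ^ Fintype.card F)^[k] y = y ^ Fintype.card F ^ k := by
  rw [pow_iterate]

theorem aux_conj_inj {p : F[X]} (hp : Irreducible p) {a : L} (ha : aeval a p = 0)
    {i j : ℕ} (hi : i < p.natDegree) (hj : j < p.natDegree)
    (hij : a ^ Fintype.card F ^ i = a ^ Fintype.card F ^ j) : i = j := by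
  wlog h : i ≤ j generalizing i j
  · exact (this hj hi hij.symm (by omega)).symm
  obtain ⟨m, rfl⟩ := Nat.exists_eq_add_of_le h
  have h1 : a ^ Fintype.card F ^ m = a := by
    apply (aux_frob_inj (F := F) (L := L)).iterate i
    rw [aux_frob_iterate, aux_frob_iterate, hij, ← pow_mul, ← pow_add, add_comm]
  have h2 := (aux_pow_iff hp ha m).1 h1
  have := Nat.eq_zero_of_dvd_of_lt h2 (by omega)
  omega

theorem aux_conj_root {p : F[X]} {a : L} (ha : aeval a p = 0) (k : ℕ) :
    aeval (a ^ Fintype.card F ^ k) p = 0 := by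
  rw [← aux_frob_iterate]
  induction k with
  | zero => exact ha
  | succ k ih =>
    rw [Function.iterate_succ_apply']
    have : ∀ y : L, y ^ Fintype.card F = FiniteField.frobeniusAlgHom F L y := fun _ => rfl
    rw [this, aeval_algHom_apply]
    beta_reduce at ih
    rw [ih, map_zero]

theorem aux_prod {p : F[X]} (hp : Irreducible p) (hm : p.Monic) {a : L} (ha : aeval a p = 0) :
    ∏ k : Fin p.natDegree, (X - C (a ^ Fintype.card F ^ (k : ℕ))) = p.map (algebraMap F L) := by
  classical
  have hinj : Function.Injective (fun k : Fin p.natDegree => a ^ Fintype.card F ^ (k : ℕ)) :=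
    fun i j hij => Fin.ext (aux_conj_inj hp ha i.2 j.2 hij)
  have hdvd : ∏ k : Fin p.natDegree, (X - C (a ^ Fintype.card F ^ (k : ℕ))) ∣
      p.map (algebraMap F L) := by
    apply Finset.prod_dvd_of_coprime
    · intro i _ j _ hij
      exact pairwise_coprime_X_sub_C hinj hij
    · intro k _
      rw [dvd_iff_isRoot, IsRoot, eval_map, ← aeval_def]
      exact aux_conj_root ha _
  refine (eq_of_monic_of_dvd_of_natDegree_le
    (monic_prod_of_monic _ _ fun k _ => monic_X_sub_C _) (hm.map _) hdvd ?_).symm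
  rw [natDegree_map, natDegree_prod_of_monic _ _ fun k _ => monic_X_sub_C _]
  simp only [natDegree_X_sub_C]
  simp

theorem aux_monicOf_monic (n : ℕ) (c : Fin n → F) : (monicOf n c).Monic := by
  unfold monicOf
  exact monic_X_pow_add (degree_sum_fin_lt c)

theorem aux_monicOf_natDegree (n : ℕ) (c : Fin n → F) : (monicOf n c).natDegree = n := by
  unfold monicOf
  rw [natDegree_add_eq_left_of_degree_lt, natDegree_X_pow]
  rw [degree_X_pow]
  exact degree_sum_fin_lt c

theorem aux_monicOf_coeff (n : ℕ) (c : Fin n → F) (i : Fin n) :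
    (monicOf n c).coeff i = c i := by
  unfold monicOf
  rw [coeff_add, coeff_X_pow, if_neg i.2.ne, zero_add, finsetSum_coeff,
    Finset.sum_eq_single i]
  · simp
  · intro j _ hj
    rw [coeff_C_mul_X_pow, if_neg]
    exact fun h => hj (Fin.ext h.symm)
  · simp

theorem aux_exists_c [Fintype L] {N n : ℕ} (hN : N ≠ 0)
    (hL : Splits ((X ^ Fintype.card F ^ N - X : F[X]).map (algebraMap F L)))
    (x : Fin n → L) (σ : Equiv.Perm (Fin n)) (hx : ∀ i, x (σ i) = x i ^ Fintype.card F) :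
    ∃ c : Fin n → F, (monicOf n c).map (algebraMap F L) = ∏ i, (X - C (x i)) := by
  set P : L[X] := ∏ i, (X - C (x i)) with hPdef
  have hPm : P.Monic := monic_prod_of_monic _ _ fun k _ => monic_X_sub_C _
  have hPd : P.natDegree = n := by
    rw [hPdef, natDegree_prod_of_monic _ _ fun k _ => monic_X_sub_C _]
    simp
  have hmap : P.map (FiniteField.frobeniusAlgHom F L : L →+* L) = P := by
    rw [hPdef, Polynomial.map_prod]
    conv_rhs => rw [← Equiv.prod_comp σ]
    refine Finset.prod_congr rfl fun i _ => ?_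
    rw [hx]
    simp
  have hco : ∀ i, ∃ a : F, algebraMap F L a = P.coeff i := by
    intro i
    apply aux_mem_range hN hL
    conv_rhs => rw [← hmap]
    rw [coeff_map]; rfl
  choose a ha using hco
  refine ⟨fun i => a i, ?_⟩
  ext i
  rw [coeff_map]
  rcases lt_trichotomy i n with h | h | h
  · rw [show i = ((⟨i, h⟩ : Fin n) : ℕ) from rfl, aux_monicOf_coeff, ha]
  · subst h
    have h1 := (aux_monicOf_monic i (fun k => a k)).coeff_natDegree
    rw [aux_monicOf_natDegree] at h1
    have h2 := hPm.coeff_natDegree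
    rw [hPd] at h2
    rw [h1, h2, map_one]
  · rw [coeff_eq_zero_of_natDegree_lt (by rwa [aux_monicOf_natDegree]),
      coeff_eq_zero_of_natDegree_lt (by rwa [hPd]), map_zero]

theorem aux_c_unique {n : ℕ} (c c' : Fin n → F)
    (h : (monicOf n c).map (algebraMap F L) = (monicOf n c').map (algebraMap F L)) : c = c' := by
  have := Polynomial.map_injective _ (algebraMap F L).injective h
  funext i
  rw [← aux_monicOf_coeff n c i, this, aux_monicOf_coeff]

end aux_field

theorem aux_hPermF_injective (f : F[X]) : Function.Injective (hPermF f) := by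
  intro h h' hh
  funext p k
  ext j
  have := congrArg (fun π : Equiv.Perm (Tf f) => π ⟨p, (j, k)⟩) hh
  simp only [hPermF, gridPerm, Equiv.sigmaCongrRight_apply, Equiv.coe_fn_mk] at this
  simpa [Fin.ext_iff] using this

theorem aux_hPermF_range {L : Type*} (f : F[X]) (x0 : Tf f → L)
    (h0 : ∀ p j k j', x0 ⟨p, (j, k)⟩ = x0 ⟨p, (j', k)⟩)
    (hx0 : ∀ t t' : Tf f, x0 t = x0 t' → t.1 = t'.1 ∧ (t.2.2 : ℕ) = t'.2.2)
    (π : Equiv.Perm (Tf f)) : (∃ h, hPermF f h = π) ↔ ∀ t, x0 (π t) = x0 t := by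
  constructor
  · rintro ⟨h, rfl⟩ ⟨p, j, k⟩
    exact h0 _ _ _ _
  · intro hπ
    have key : ∀ ρ : Equiv.Perm (Tf f), (∀ t, x0 (ρ t) = x0 t) →
        ∀ p j k, ∃ j', ρ ⟨p, (j, k)⟩ = ⟨p, (j', k)⟩ := by
      intro ρ hρ p j k
      obtain ⟨h1, h2⟩ := hx0 _ _ (hρ ⟨p, (j, k)⟩)
      generalize ρ ⟨p, (j, k)⟩ = t at h1 h2
      obtain ⟨p', j', k'⟩ := t
      dsimp only at h1
      subst h1
      dsimp only at h2
      exact ⟨j', by rw [Fin.ext h2]⟩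
    choose u hu using key π hπ
    choose v hv using key π⁻¹ (fun t => by
      have := hπ (π⁻¹ t)
      rw [← this]; simp)
    refine ⟨fun p k => ⟨fun j => u p j k, fun j => v p j k, ?_, ?_⟩, ?_⟩
    · intro j
      have h1 := hv p (u p j k) k
      rw [← hu p j k, Equiv.Perm.inv_def, Equiv.symm_apply_apply] at h1
      simpa using h1.symm
    · intro j
      have h1 := hu p (v p j k) k
      rw [← hv p j k, Equiv.Perm.inv_def, Equiv.apply_symm_apply] at h1
      simpa using h1.symm
    · ext1 ⟨p, j, k⟩
      rw [hu]
      rfl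

theorem aux_labelling {L : Type*} [Field L] [Algebra F L] [Fintype F] {N n : ℕ} (hN : N ≠ 0)
    (hnN : ∀ k, 0 < k → k ≤ n → k ∣ N)
    (hL : Splits ((X ^ Fintype.card F ^ N - X : F[X]).map (algebraMap F L)))
    (f : F[X]) (hf : f.Monic) (hfn : f.natDegree = n) :
    ∃ x0 : Tf f → L, (∀ t, x0 (tauF f t) = x0 t ^ Fintype.card F) ∧
      (∀ π : Equiv.Perm (Tf f), (∃ h, hPermF f h = π) ↔ ∀ t, x0 (π t) = x0 t) ∧
      ∏ t, (X - C (x0 t)) = f.map (algebraMap F L) := by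
  have hirr : ∀ p : {x // x ∈ facSet f}, Irreducible (p : F[X]) := fun p =>
    irreducible_of_normalized_factor _ (Multiset.mem_toFinset.1 p.2)
  have hmon : ∀ p : {x // x ∈ facSet f}, (p : F[X]).Monic := fun p => by
    rw [← normalize_normalized_factor _ (Multiset.mem_toFinset.1 p.2)]
    exact monic_normalize (hirr p).ne_zero
  have hroot : ∀ p : {x // x ∈ facSet f}, ∃ a : L, aeval a (p : F[X]) = 0 := fun p => by
    apply aux_root hN hL (hirr p)
    apply hnN _ (hirr p).natDegree_pos
    rw [← hfn]
    exact natDegree_le_of_dvd (dvd_of_mem_normalizedFactors (Multiset.mem_toFinset.1 p.2))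
      hf.ne_zero
  choose a ha using hroot
  refine ⟨fun t => a t.1 ^ Fintype.card F ^ (t.2.2 : ℕ), ?_, ?_, ?_⟩
  · rintro ⟨p, j, k⟩
    change a p ^ Fintype.card F ^ ((finRotate _ k : Fin _) : ℕ) =
      (a p ^ Fintype.card F ^ (k : ℕ)) ^ Fintype.card F
    rw [← pow_mul, ← pow_succ]
    have hd := (aux_pow_iff (hirr p) (ha p) (p : F[X]).natDegree).2 dvd_rfl
    clear j
    revert hd k
    generalize (p : F[X]).natDegree = d
    intro k hd
    cases d with
    | zero => exact k.elim0
    | succ d =>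
      rw [coe_finRotate]
      split_ifs with h
      · rw [h, Fin.val_last, hd, pow_zero, pow_one]
      · rfl
  · refine aux_hPermF_range f (fun t => a t.1 ^ Fintype.card F ^ (t.2.2 : ℕ)) ?_ ?_
    · intro p j k j'; rfl
    · rintro ⟨p, j, k⟩ ⟨p', j', k'⟩ h
      have hp : p = p' := by
        have h1 := aux_conj_root (ha p) (k : ℕ)
        have h2 := aux_conj_root (ha p') (k' : ℕ)
        dsimp only at h
        rw [← h] at h2
        apply Subtype.ext
        apply eq_of_monic_of_associated (hmon p) (hmon p')
        exact associated_of_dvd_dvd (((hirr p).dvd_iff_aeval_eq_zero h1).1 h2)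
          (((hirr p').dvd_iff_aeval_eq_zero h2).1 h1)
      subst hp
      exact ⟨rfl, aux_conj_inj (hirr p) (ha p) k.2 k'.2 h⟩
  · rw [Fintype.prod_sigma]
    have h1 : ∀ p : {x // x ∈ facSet f},
        ∏ y : Fin ((normalizedFactors f).count (p : F[X])) × Fin ((p : F[X]).natDegree),
          (X - C (a p ^ Fintype.card F ^ (y.2 : ℕ))) =
        ((p : F[X]) ^ ((normalizedFactors f).count (p : F[X]))).map (algebraMap F L) := by
      intro p
      rw [Fintype.prod_prod_type]
      simp only
      rw [aux_prod (hirr p) (hmon p) (ha p)]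
      simp
    rw [Finset.prod_congr rfl fun p _ => h1 p, ← Polynomial.map_prod]
    congr 1
    rw [Finset.prod_coe_sort (facSet f) (fun p => p ^ ((normalizedFactors f).count p)), facSet,
      ← Finset.prod_multiset_count, prod_normalizedFactors_eq, hf.normalize_eq_self]
    exact hf.ne_zero

theorem aux_match {L T : Type*} [Field L] [Fintype T] {n : ℕ} (x0 : T → L) (x : Fin n → L) :
    (∃ g : T ≃ Fin n, ∀ t, x (g t) = x0 t) ↔ ∏ t, (X - C (x0 t)) = ∏ i, (X - C (x i)) := by
  constructor
  · rintro ⟨g, hg⟩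
    rw [← Equiv.prod_comp g]
    simp_rw [hg]
  · intro h
    apply aux_exists_equiv
    have h1 := congrArg roots h
    rw [← Finset.prod_map_val, ← Finset.prod_map_val] at h1
    have h2 : ∀ s : Multiset L, (s.map fun a => X - C a).prod.roots = s :=
      roots_multiset_prod_X_sub_C
    rw [← h2 (Finset.univ.val.map x0), ← h2 (Finset.univ.val.map x), Multiset.map_map,
      Multiset.map_map]
    exact h1

/-- Equal expectations: for every class function `χ` on `S_n`, the average over the `q^n`
monic degree-`n` polynomials `f` of `χ(σ_f)` — the average of `χ` over the coset
`τ_f H_f` (transported to `S_n` by any identification `e` of the roots of `f` with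
`{1,…,n}`) — equals the average of `χ` over `S_n`. -/
theorem stmt13 [Fintype F] (n : ℕ) (hn : 1 ≤ n)
    (χ : Equiv.Perm (Fin n) → ℚ)
    (hχ : ∀ g h : Equiv.Perm (Fin n), χ (h * g * h⁻¹) = χ g)
    (e : ∀ c : Fin n → F, Tf (monicOf n c) ≃ Fin n) :
    ((Fintype.card F : ℚ) ^ n)⁻¹ *
        ∑ c : Fin n → F,
          ((Fintype.card (Hf (monicOf n c)) : ℚ))⁻¹ *
            ∑ h : Hf (monicOf n c),
              χ ((e c).permCongr (tauF (monicOf n c) * hPermF (monicOf n c) h))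
      = ((Nat.factorial n : ℚ))⁻¹ * ∑ σ : Equiv.Perm (Fin n), χ σ := by
  classical
  have hN : Nat.factorial n ≠ 0 := Nat.factorial_ne_zero n
  have hnN : ∀ k, 0 < k → k ≤ n → k ∣ Nat.factorial n := fun k h1 h2 =>
    Nat.dvd_factorial h1 h2
  let L := SplittingField (X ^ Fintype.card F ^ Nat.factorial n - X : F[X])
  have hL : Splits ((X ^ Fintype.card F ^ Nat.factorial n - X : F[X]).map (algebraMap F L)) :=
    SplittingField.splits _
  have : Finite L := Module.finite_of_finite F
  let _ : Fintype L := Fintype.ofFinite L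
  let φ : L → L := fun y => y ^ Fintype.card F
  let B : (Fin n → L) → ℚ := fun x =>
    ∑ σ ∈ Finset.univ.filter (fun σ : Equiv.Perm (Fin n) => ∀ i, x (σ i) = φ (x i)), χ σ
  have hcount : ∀ σ : Equiv.Perm (Fin n),
      (Finset.univ.filter (fun x : Fin n → L => ∀ i, x (σ i) = φ (x i))).card =
        Fintype.card F ^ n := by
    intro σ
    have := aux_orbit_count φ (Fintype.card F) (fun k hk hkn => by
      rw [Fintype.card_fin] at hkn
      rw [← aux_fix_count hN hk (hnN k hk hkn) hL]
      exact Nat.card_congr (Equiv.subtypeEquivRight fun y => by rw [aux_frob_iterate])) σ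
    rw [Fintype.card_fin, Nat.card_eq_fintype_card, Fintype.card_subtype] at this
    exact this
  have htotal : ∑ x, B x = (Fintype.card F : ℚ) ^ n * ∑ σ, χ σ := by
    simp only [B, Finset.sum_filter]
    rw [Finset.sum_comm, Finset.mul_sum]
    refine Finset.sum_congr rfl fun σ _ => ?_
    rw [← Finset.sum_filter, Finset.sum_const, hcount, nsmul_eq_mul]
    push_cast
    rfl
  have hpart : ∑ x, B x = ∑ c : Fin n → F, ∑ x ∈ Finset.univ.filter (fun x : Fin n → L =>
      (monicOf n c).map (algebraMap F L) = ∏ i, (X - C (x i))), B x := by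
    simp only [Finset.sum_filter (s := (Finset.univ : Finset (Fin n → L)))]
    rw [Finset.sum_comm]
    refine Finset.sum_congr rfl fun x _ => ?_
    by_cases hx : ∃ σ : Equiv.Perm (Fin n), ∀ i, x (σ i) = φ (x i)
    · obtain ⟨σ, hσ⟩ := hx
      obtain ⟨c, hc⟩ := aux_exists_c hN hL x σ hσ
      rw [Finset.sum_eq_single c, if_pos hc]
      · intro c' _ hc'
        rw [if_neg]
        intro h
        exact hc' (aux_c_unique (L := L) _ _ (h.trans hc.symm))
      · simp
    · have : B x = 0 := by
        simp only [B]
        rw [Finset.filter_false_of_mem, Finset.sum_empty]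
        intro σ _ h
        exact hx ⟨σ, h⟩
      simp [this]
  have hc : ∀ c : Fin n → F, ((Fintype.card (Hf (monicOf n c)) : ℚ))⁻¹ *
            ∑ h : Hf (monicOf n c),
              χ ((e c).permCongr (tauF (monicOf n c) * hPermF (monicOf n c) h)) =
      (Nat.factorial n : ℚ)⁻¹ * ∑ x ∈ Finset.univ.filter (fun x : Fin n → L =>
      (monicOf n c).map (algebraMap F L) = ∏ i, (X - C (x i))), B x := by
    intro c
    obtain ⟨x0, h1, h2, h3⟩ := aux_labelling hN hnN hL (monicOf n c) (aux_monicOf_monic n c)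
      (aux_monicOf_natDegree n c)
    have h4 := aux_coset_sum x0 (tauF (monicOf n c)) φ (aux_frob_inj (F := F) (L := L)) h1
      (hPermF (monicOf n c)) (aux_hPermF_injective _) h2 χ hχ (e c)
    simp only [aux_match, h3] at h4
    have h5 : (Fintype.card (Hf (monicOf n c)) : ℚ) ≠ 0 := by
      exact_mod_cast Fintype.card_ne_zero
    have h6 : (Nat.factorial n : ℚ) ≠ 0 := by exact_mod_cast hN
    rw [inv_mul_eq_iff_eq_mul₀ h5, mul_left_comm, eq_inv_mul_iff_mul_eq₀ h6]
    exact h4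
  rw [Finset.sum_congr rfl fun c _ => hc c, ← Finset.mul_sum, ← hpart, htotal]
  have h7 : (Fintype.card F : ℚ) ^ n ≠ 0 :=
    pow_ne_zero _ (by exact_mod_cast Fintype.card_ne_zero)
  rw [mul_left_comm, inv_mul_cancel_left₀ h7]
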